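/- arXiv:1807.01584 — 2 statements merged into one kernel-verified Lean document; each statement's English description precedes it below -/
import Mathlib

section
/- Let P be a simple polyomino and let (P₁, P₂) be a vertical straight 2-cut of P at position c (not necessarily valid). Let {i, j} = {1, 2}. If there exist a tile t ∈ P_i and tiles q₁, q₂ ∈ P_j all in the same row with q₁ strictly to the left of t and q₂ strictly to the right of t, then there exist a locally convex tile t' ∈ P_i and tiles q₁', q₂' ∈ P_j in the same row as t' with q₁' strictly to the left of t' and q₂' strictly to the right of t'. In other words, it suffices to consider locally convex tiles for checking whether a straight 2-cut is valid. -/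
/-- Two grid points are adjacent if they are at Euclidean distance 1. -/
def Adj (p q : ℤ × ℤ) : Prop := |p.1 - q.1| + |p.2 - q.2| = 1

/-- A set of grid points induces a connected grid graph. -/
def GridConnected (S : Set (ℤ × ℤ)) : Prop :=
  ∀ p ∈ S, ∀ q ∈ S,
    Relation.ReflTransGen (fun a b => a ∈ S ∧ b ∈ S ∧ Adj a b) p q

/-- A polyomino: a finite nonempty set of grid points with connected grid graph. -/
def IsPolyomino (P : Finset (ℤ × ℤ)) : Prop :=
  P.Nonempty ∧ GridConnected ↑P

/-- x-monotone (column convex). -/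
def ColumnConvex (S : Set (ℤ × ℤ)) : Prop :=
  ∀ x y₁ y₂ y : ℤ, (x, y₁) ∈ S → (x, y₂) ∈ S → y₁ ≤ y → y ≤ y₂ → (x, y) ∈ S

/-- y-monotone (row convex). -/
def RowConvex (S : Set (ℤ × ℤ)) : Prop :=
  ∀ y x₁ x₂ x : ℤ, (x₁, y) ∈ S → (x₂, y) ∈ S → x₁ ≤ x → x ≤ x₂ → (x, y) ∈ S

/-- Orthogonally convex. -/
def OrthoConvex (S : Set (ℤ × ℤ)) : Prop := ColumnConvex S ∧ RowConvex S

/-- Simple (hole-free): the complement induces a connected grid graph. -/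
def SimplePoly (P : Finset (ℤ × ℤ)) : Prop :=
  GridConnected ((↑P : Set (ℤ × ℤ))ᶜ)

/-- Left piece of the vertical cut at `c`. -/
def PLe (P : Finset (ℤ × ℤ)) (c : ℤ) : Finset (ℤ × ℤ) :=
  P.filter (fun p => p.1 ≤ c)

/-- Right piece of the vertical cut at `c`. -/
def PGt (P : Finset (ℤ × ℤ)) (c : ℤ) : Finset (ℤ × ℤ) :=
  P.filter (fun p => c < p.1)

/-- Vertical straight 2-cut of `P` at position `c` into left piece `P₁` and right
piece `P₂`. -/
def IsVCut (P P₁ P₂ : Finset (ℤ × ℤ)) (c : ℤ) : Prop :=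
  P₁ ∪ P₂ = P ∧ Disjoint P₁ P₂ ∧ P₁.Nonempty ∧ P₂.Nonempty ∧
  GridConnected ↑P₁ ∧ GridConnected ↑P₂ ∧
  ∀ p ∈ P₁, ∀ q ∈ P₂, Adj p q → p.1 = c ∧ q.1 = c + 1 ∧ p.2 = q.2

/-- Valid vertical straight 2-cut: the pieces can be pulled apart horizontally. -/
def ValidVCut (P P₁ P₂ : Finset (ℤ × ℤ)) (c : ℤ) : Prop :=
  IsVCut P P₁ P₂ c ∧ ∀ k : ℤ, 1 ≤ k → ∀ p ∈ P₂, (p.1 + k, p.2) ∉ P₁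

/-- Horizontal straight 2-cut of `P` at position `c` into bottom piece `P₁` and
top piece `P₂` (coordinates exchanged). -/
def IsHCut (P P₁ P₂ : Finset (ℤ × ℤ)) (c : ℤ) : Prop :=
  P₁ ∪ P₂ = P ∧ Disjoint P₁ P₂ ∧ P₁.Nonempty ∧ P₂.Nonempty ∧
  GridConnected ↑P₁ ∧ GridConnected ↑P₂ ∧
  ∀ p ∈ P₁, ∀ q ∈ P₂, Adj p q → p.2 = c ∧ q.2 = c + 1 ∧ p.1 = q.1

/-- Valid horizontal straight 2-cut: the pieces can be pulled apart vertically. -/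
def ValidHCut (P P₁ P₂ : Finset (ℤ × ℤ)) (c : ℤ) : Prop :=
  IsHCut P P₁ P₂ c ∧ ∀ k : ℤ, 1 ≤ k → ∀ p ∈ P₂, (p.1, p.2 + k) ∉ P₁

/-- The part of the decomposition of `P` by the vertical cut positions `C`
that contains the point `p`. -/
def CutPart (P : Finset (ℤ × ℤ)) (C : Finset ℤ) (p : ℤ × ℤ) : Finset (ℤ × ℤ) :=
  P.filter (fun q => ∀ c ∈ C, (q.1 ≤ c ↔ p.1 ≤ c))

/-- The vertical cut positions `C` decompose `P` into orthogonally convex parts. -/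
def Decomposes (P : Finset (ℤ × ℤ)) (C : Finset ℤ) : Prop :=
  ∀ p ∈ P, OrthoConvex ↑(CutPart P C p)

/-- The decomposition number `d(P)`: the minimum number of vertical cut positions
decomposing `P` into orthogonally convex parts. -/
noncomputable def decompNumber (P : Finset (ℤ × ℤ)) : ℕ :=
  sInf {k | ∃ C : Finset ℤ, C.card = k ∧ Decomposes P C}

/-- `(a, b, y₀)` is a minimum of the upper envelope of `P`. -/
def UpperEnvMin (P : Set (ℤ × ℤ)) (a b y₀ : ℤ) : Prop :=
  a + 2 ≤ b ∧ (∀ x : ℤ, a ≤ x → x ≤ b → (x, y₀) ∈ P) ∧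
  (a, y₀ + 1) ∈ P ∧ (b, y₀ + 1) ∈ P ∧ ∀ x : ℤ, a < x → x < b → (x, y₀ + 1) ∉ P

/-- `(a, b, y₀)` is a maximum of the lower envelope of `P`. -/
def LowerEnvMax (P : Set (ℤ × ℤ)) (a b y₀ : ℤ) : Prop :=
  a + 2 ≤ b ∧ (∀ x : ℤ, a ≤ x → x ≤ b → (x, y₀) ∈ P) ∧
  (a, y₀ - 1) ∈ P ∧ (b, y₀ - 1) ∈ P ∧ ∀ x : ℤ, a < x → x < b → (x, y₀ - 1) ∉ P

/-- The four cells of the 2×2 square with lower-left corner `s`. -/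
def SquareCells (s : ℤ × ℤ) : Finset (ℤ × ℤ) :=
  {s, (s.1 + 1, s.2), (s.1, s.2 + 1), (s.1 + 1, s.2 + 1)}

/-- A 2×2 square (given by its lower-left corner `s`) is a reflex witness of `P`
if it contains exactly three points of `P`. -/
def ReflexWitness (P : Finset (ℤ × ℤ)) (s : ℤ × ℤ) : Prop :=
  (SquareCells s ∩ P).card = 3

/-- The number of reflex witnesses of `P`. -/
noncomputable def wRef (P : Finset (ℤ × ℤ)) : ℕ :=
  Set.ncard {s : ℤ × ℤ | ReflexWitness P s}

/-- A tile `t` is locally reflex: it is the corner tile of some reflex witness,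
i.e. the square cell opposite to `t` is the one missing from `P`. -/
def LocallyReflex (P : Finset (ℤ × ℤ)) (t : ℤ × ℤ) : Prop :=
  ∃ s : ℤ × ℤ, ReflexWitness P s ∧ t ∈ SquareCells s ∧
    (2 * s.1 + 1 - t.1, 2 * s.2 + 1 - t.2) ∉ P

/-- The number of locally reflex tiles of `P`. -/
noncomputable def rRef (P : Finset (ℤ × ℤ)) : ℕ :=
  Set.ncard {t : ℤ × ℤ | LocallyReflex P t}

/-- A tile `t` is locally convex: some 2×2 square contains `t` and no other
point of `P`. -/
def LocallyConvex (P : Finset (ℤ × ℤ)) (t : ℤ × ℤ) : Prop :=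
  ∃ s : ℤ × ℤ, t ∈ SquareCells s ∧ SquareCells s ∩ P = {t}

/-- A straight 2-cut `(P₁, P₂)` is along a locally reflex tile of `P`. -/
def AlongReflex (P P₁ P₂ : Finset (ℤ × ℤ)) : Prop :=
  ∃ s : ℤ × ℤ, ReflexWitness P s ∧ (SquareCells s ∩ P₁).Nonempty ∧
    (SquareCells s ∩ P₂).Nonempty

/-- A valid (not necessarily straight) 2-cut of `P` into `P₁` and `P₂`. -/
def ValidCut (P P₁ P₂ : Finset (ℤ × ℤ)) : Prop :=
  P₁ ∪ P₂ = P ∧ Disjoint P₁ P₂ ∧ P₁.Nonempty ∧ P₂.Nonempty ∧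
  GridConnected ↑P₁ ∧ GridConnected ↑P₂ ∧
  ∃ v ∈ ({(1, 0), (-1, 0), (0, 1), (0, -1)} : Set (ℤ × ℤ)),
    ∀ k : ℤ, 1 ≤ k → ∀ p ∈ P₂, (p.1 + k * v.1, p.2 + k * v.2) ∉ P₁

/-- A polyomino is 2-cuttable: it is orthogonally convex, or some valid 2-cut
splits it into two 2-cuttable polyominoes. -/
inductive TwoCuttable : Finset (ℤ × ℤ) → Prop
  | convex (P : Finset (ℤ × ℤ)) : IsPolyomino P → OrthoConvex ↑P → TwoCuttable P
  | cut (P P₁ P₂ : Finset (ℤ × ℤ)) : ValidCut P P₁ P₂ →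
      TwoCuttable P₁ → TwoCuttable P₂ → TwoCuttable P

/-- A polyomino is straight 2-cuttable: it is orthogonally convex, or some valid
vertical or horizontal straight 2-cut splits it into two straight 2-cuttable
polyominoes. -/
inductive Straight2Cuttable : Finset (ℤ × ℤ) → Prop
  | convex (P : Finset (ℤ × ℤ)) : IsPolyomino P → OrthoConvex ↑P → Straight2Cuttable P
  | vcut (P P₁ P₂ : Finset (ℤ × ℤ)) (c : ℤ) : ValidVCut P P₁ P₂ c →
      Straight2Cuttable P₁ → Straight2Cuttable P₂ → Straight2Cuttable P
  | hcut (P P₁ P₂ : Finset (ℤ × ℤ)) (c : ℤ) : ValidHCut P P₁ P₂ c →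
      Straight2Cuttable P₁ → Straight2Cuttable P₂ → Straight2Cuttable P

theorem aux_flux (S : Set (ℤ × ℤ)) (u v : ℤ × ℤ)
    (h : Relation.ReflTransGen (fun a b => a ∈ S ∧ b ∈ S ∧ Adj a b) u v) :
    ∃ h : ℤ → ℤ → ℤ,
      (∀ x y, ((x, y + 1) ∉ S ∨ (x + 1, y + 1) ∉ S) → h x y = h x (y + 1)) ∧
      (∀ x y, (x + 1, y) ∉ S → h x y - h (x + 1) y =
        (if v.1 = x + 1 ∧ y < v.2 then 1 else 0) - (if u.1 = x + 1 ∧ y < u.2 then 1 else 0)) := by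
  induction h with
  | refl => exact ⟨fun _ _ => 0, by simp, by simp⟩
  | @tail b d _ hbd ih =>
    obtain ⟨h, h1, h2⟩ := ih
    obtain ⟨hb, hd, hadj⟩ := hbd
    obtain ⟨b1, b2⟩ := b
    obtain ⟨d1, d2⟩ := d
    have hcase : (d1 = b1 + 1 ∧ d2 = b2) ∨ (b1 = d1 + 1 ∧ d2 = b2) ∨
        (d1 = b1 ∧ d2 = b2 + 1) ∨ (d1 = b1 ∧ b2 = d2 + 1) := by
      simp only [Adj] at hadj
      rcases abs_cases (b1 - d1) with ⟨e1, _⟩ | ⟨e1, _⟩ <;>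
        rcases abs_cases (b2 - d2) with ⟨e2, _⟩ | ⟨e2, _⟩ <;> rw [e1, e2] at hadj <;> omega
    refine ⟨fun x y => h x y + ((if b1 = x ∧ d1 = x + 1 ∧ y < b2 then 1 else 0) -
      (if d1 = x ∧ b1 = x + 1 ∧ y < b2 then 1 else 0)), ?_, ?_⟩
    · intro x y hxy
      have e := h1 x y hxy
      have n1 : ¬ (b1 = x ∧ d1 = x + 1 ∧ b2 = y + 1) := by
        rintro ⟨rfl, rfl, rfl⟩
        have : d2 = y + 1 := by omega
        subst this
        tauto
      have n2 : ¬ (d1 = x ∧ b1 = x + 1 ∧ b2 = y + 1) := by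
        rintro ⟨rfl, rfl, rfl⟩
        have : d2 = y + 1 := by omega
        subst this
        tauto
      simp only [e]
      congr 2 <;> (split_ifs <;> omega)
    · intro x y hxy
      have e := h2 x y hxy
      have n1 : ¬ (b1 = x + 1 ∧ b2 = y) := by
        rintro ⟨rfl, rfl⟩; exact hxy hb
      have n2 : ¬ (d1 = x + 1 ∧ d2 = y) := by
        rintro ⟨rfl, rfl⟩; exact hxy hd
      simp only at e ⊢
      have : (if d1 = x + 1 ∧ y < d2 then (1:ℤ) else 0) - (if b1 = x + 1 ∧ y < b2 then 1 else 0)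
        = ((if b1 = x ∧ d1 = x + 1 ∧ y < b2 then 1 else 0) -
          (if d1 = x ∧ b1 = x + 1 ∧ y < b2 then 1 else 0)) -
          ((if b1 = x + 1 ∧ d1 = x + 1 + 1 ∧ y < b2 then 1 else 0) -
          (if d1 = x + 1 ∧ b1 = x + 1 + 1 ∧ y < b2 then 1 else 0)) := by
        clear e h1 h2 h hadj hb hd
        rcases hcase with ⟨rfl, rfl⟩ | ⟨rfl, rfl⟩ | ⟨rfl, rfl⟩ | ⟨rfl, rfl⟩ <;>
          split_ifs <;> omega
      linarith

theorem aux_diag (S : Set (ℤ × ℤ)) (hS : GridConnected S) (hC : GridConnected Sᶜ) (a b : ℤ)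
    (hu : (a + 1, b) ∈ S) (hv : (a, b + 1) ∈ S) (he : (a, b) ∉ S) (hf : (a + 1, b + 1) ∉ S) :
    False := by
  obtain ⟨h, h1, h2⟩ := aux_flux S _ _ (hS _ hu _ hv)
  have key : ∀ z, Relation.ReflTransGen (fun a b => a ∈ Sᶜ ∧ b ∈ Sᶜ ∧ Adj a b) (a, b) z →
      h z.1 z.2 + (if z.1 = a ∧ z.2 < b + 1 then 1 else 0) = h a b + 1 := by
    intro z hz
    induction hz with
    | refl => simp
    | @tail p q _ hpq ih =>
      obtain ⟨hp, hq, hadj⟩ := hpq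
      obtain ⟨p1, p2⟩ := p
      obtain ⟨q1, q2⟩ := q
      rw [← ih]
      have hcase : (q1 = p1 + 1 ∧ q2 = p2) ∨ (p1 = q1 + 1 ∧ q2 = p2) ∨
          (q1 = p1 ∧ q2 = p2 + 1) ∨ (q1 = p1 ∧ p2 = q2 + 1) := by
        simp only [Adj] at hadj
        rcases abs_cases (p1 - q1) with ⟨e1, _⟩ | ⟨e1, _⟩ <;>
          rcases abs_cases (p2 - q2) with ⟨e2, _⟩ | ⟨e2, _⟩ <;> rw [e1, e2] at hadj <;> omega
      have hp' : (p1, p2) ∉ S := hp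
      have hq' : (q1, q2) ∉ S := hq
      have n1 : ¬ (p1 = a + 1 ∧ p2 = b) := by rintro ⟨rfl, rfl⟩; exact hp' hu
      have n2 : ¬ (q1 = a + 1 ∧ q2 = b) := by rintro ⟨rfl, rfl⟩; exact hq' hu
      have n3 : ¬ (p1 = a ∧ p2 = b + 1) := by rintro ⟨rfl, rfl⟩; exact hp' hv
      have n4 : ¬ (q1 = a ∧ q2 = b + 1) := by rintro ⟨rfl, rfl⟩; exact hq' hv
      clear ih hadj hp hq
      rcases hcase with ⟨rfl, rfl⟩ | ⟨rfl, rfl⟩ | ⟨rfl, rfl⟩ | ⟨rfl, rfl⟩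
      · have e := h2 p1 q2 hq'
        simp only at e ⊢
        split_ifs at e ⊢ <;> omega
      · have e := h2 q1 q2 hp'
        simp only at e ⊢
        split_ifs at e ⊢ <;> omega
      · have e := h1 q1 p2 (Or.inl hq')
        simp only at e ⊢
        split_ifs at e ⊢ <;> omega
      · have e := h1 q1 q2 (Or.inl hp')
        simp only at e ⊢
        split_ifs at e ⊢ <;> omega
  have k := key _ (hC _ he _ hf)
  have e1 := h1 a b (Or.inr hf)
  have e2 := h2 a (b + 1) hf
  simp only at k e1 e2
  split_ifs at k e2 <;> omega

theorem aux_reflect (S : Set (ℤ × ℤ)) (hS : GridConnected S) :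
    GridConnected {p : ℤ × ℤ | (-p.1, p.2) ∈ S} := by
  intro p hp q hq
  have := hS _ hp _ hq
  have key : ∀ z, Relation.ReflTransGen (fun a b => a ∈ S ∧ b ∈ S ∧ Adj a b) (-p.1, p.2) z →
      Relation.ReflTransGen (fun a b => a ∈ {p : ℤ × ℤ | (-p.1, p.2) ∈ S} ∧
        b ∈ {p : ℤ × ℤ | (-p.1, p.2) ∈ S} ∧ Adj a b) p (-z.1, z.2) := by
    intro z hz
    induction hz with
    | refl => simpa using Relation.ReflTransGen.refl
    | @tail a b _ hab ih =>
      refine ih.tail ?_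
      obtain ⟨a1, a2⟩ := a
      obtain ⟨b1, b2⟩ := b
      obtain ⟨ha, hb, hab⟩ := hab
      refine ⟨by simpa using ha, by simpa using hb, ?_⟩
      simp only [Adj] at hab ⊢
      rw [← hab, show -a1 - -b1 = -(a1 - b1) by ring, abs_neg]
  simpa using key _ this

theorem aux_diag' (S : Set (ℤ × ℤ)) (hS : GridConnected S) (hC : GridConnected Sᶜ) (a b : ℤ)
    (hu : (a + 1, b) ∉ S) (hv : (a, b + 1) ∉ S) (he : (a, b) ∈ S) (hf : (a + 1, b + 1) ∈ S) :
    False := by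
  refine aux_diag _ (aux_reflect S hS) (aux_reflect _ hC) (-a - 1) b ?_ ?_ ?_ ?_
  · simpa using he
  · simpa [add_comm] using hf
  · simpa [add_comm] using hu
  · simpa using hv

theorem aux_diag_gen (S : Set (ℤ × ℤ)) (hS : GridConnected S) (hC : GridConnected Sᶜ)
    (σ δ a b : ℤ) (hσ : σ = 1 ∨ σ = -1) (hδ : δ = 1 ∨ δ = -1)
    (h1 : (a, b) ∈ S) (h2 : (a - σ, b) ∉ S) (h3 : (a, b + δ) ∉ S) : (a - σ, b + δ) ∉ S := by
  intro h4
  rcases hσ with rfl | rfl <;> rcases hδ with rfl | rfl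
  · exact aux_diag S hS hC (a - 1) b (by simpa using h1) h4 h2 (by simpa using h3)
  · exact aux_diag' S hS hC (a - 1) (b - 1) (by simpa [sub_eq_add_neg] using h3) (by simpa using h2)
      h4 (by simpa using h1)
  · exact aux_diag' S hS hC a b (by simpa using h2) h3 h1 (by simpa using h4)
  · exact aux_diag S hS hC a (b - 1) (by simpa [sub_eq_add_neg] using h4)
      (by simpa using h1) h3 (by simpa using h2)

theorem aux_lc (P : Finset (ℤ × ℤ)) (σ δ a b : ℤ) (hσ : σ = 1 ∨ σ = -1) (hδ : δ = 1 ∨ δ = -1)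
    (h1 : (a, b) ∈ P) (h2 : (a - σ, b) ∉ P) (h3 : (a, b + δ) ∉ P) (h4 : (a - σ, b + δ) ∉ P) :
    LocallyConvex P (a, b) := by
  have gen : ∀ s : ℤ × ℤ, (∀ p : ℤ × ℤ, p ∈ SquareCells s ↔
      p = (a, b) ∨ p = (a - σ, b) ∨ p = (a, b + δ) ∨ p = (a - σ, b + δ)) →
      LocallyConvex P (a, b) := by
    intro s hs
    refine ⟨s, (hs _).2 (Or.inl rfl), ?_⟩
    ext p
    rw [Finset.mem_inter, hs, Finset.mem_singleton]
    constructor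
    · rintro ⟨rfl | rfl | rfl | rfl, hp⟩
      · rfl
      · exact absurd hp h2
      · exact absurd hp h3
      · exact absurd hp h4
    · rintro rfl
      exact ⟨Or.inl rfl, h1⟩
  rcases hσ with rfl | rfl <;> rcases hδ with rfl | rfl
  · refine gen (a - 1, b) ?_
    rintro ⟨x, y⟩
    simp only [SquareCells, Finset.mem_insert, Finset.mem_singleton, Prod.mk.injEq]; omega
  · refine gen (a - 1, b - 1) ?_
    rintro ⟨x, y⟩
    simp only [SquareCells, Finset.mem_insert, Finset.mem_singleton, Prod.mk.injEq]; omega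
  · refine gen (a, b) ?_
    rintro ⟨x, y⟩
    simp only [SquareCells, Finset.mem_insert, Finset.mem_singleton, Prod.mk.injEq]; omega
  · refine gen (a, b - 1) ?_
    rintro ⟨x, y⟩
    simp only [SquareCells, Finset.mem_insert, Finset.mem_singleton, Prod.mk.injEq]; omega

/-- The end of the run of `A` through `t` in direction `-σ`. -/
theorem aux_run (A : Finset (ℤ × ℤ)) (σ : ℤ) (hσ : σ = 1 ∨ σ = -1) (x y : ℤ)
    (ht : (x, y) ∈ A) : ∃ k : ℕ, (∀ i : ℕ, i ≤ k → (x - σ * i, y) ∈ A) ∧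
      (x - σ * (k + 1), y) ∉ A := by
  have hex : ∃ k : ℕ, (x - σ * k, y) ∉ A := by
    by_contra! hcon
    have hinj : Function.Injective (fun k : ℕ => ((x - σ * k, y) : ℤ × ℤ)) := by
      intro i j hij
      simp only [Prod.mk.injEq] at hij
      rcases hσ with rfl | rfl <;> omega
    exact Set.infinite_of_injective_forall_mem (s := (↑A : Set (ℤ × ℤ))) hinj
      (fun k => by simpa using hcon k) A.finite_toSet
  classical
  have hspec := Nat.find_spec hex
  have hmin := fun m => Nat.find_min hex (m := m)
  set n := Nat.find hex
  rcases n with _ | k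
  · simp at hspec; exact absurd ht hspec
  · refine ⟨k, fun i hi => ?_, by simpa using hspec⟩
    have := hmin i (by omega)
    simpa using this

theorem aux_main (P A B : Finset (ℤ × ℤ)) (hP : GridConnected (↑P : Set (ℤ × ℤ)))
    (hs : GridConnected ((↑P : Set (ℤ × ℤ))ᶜ)) (hU : ∀ p, p ∈ P ↔ p ∈ A ∨ p ∈ B)
    (hD : ∀ p, p ∈ A → p ∈ B → False) (hB : GridConnected (↑B : Set (ℤ × ℤ)))
    (σ : ℤ) (hσ : σ = 1 ∨ σ = -1)
    (hcut : ∀ p ∈ A, ∀ q ∈ B, Adj p q → q.1 = p.1 + σ ∧ q.2 = p.2)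
    (t q₁ q₂ : ℤ × ℤ) (ht : t ∈ A) (hq₁ : q₁ ∈ B) (hq₂ : q₂ ∈ B)
    (hrow₁ : q₁.2 = t.2) (hrow₂ : q₂.2 = t.2)
    (hleft : q₁.1 < t.1) (hright : t.1 < q₂.1) :
    ∃ t' ∈ A, LocallyConvex P t' ∧ ∃ q₁' ∈ B, ∃ q₂' ∈ B,
      q₁'.2 = t'.2 ∧ q₂'.2 = t'.2 ∧ q₁'.1 < t'.1 ∧ t'.1 < q₂'.1 := by
  by_contra hno
  -- a blocked tile continues in direction δ
  have step : ∀ δ : ℤ, (δ = 1 ∨ δ = -1) → ∀ x y x₁ x₂ : ℤ, (x, y) ∈ A → (x₁, y) ∈ B →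
      (x₂, y) ∈ B → x₁ < x → x < x₂ →
      ∃ a : ℤ, (a, y + δ) ∈ A ∧ ∀ z, (z, y) ∈ B → ((z < x ↔ z < a) ∧ z ≠ a) := by
    intro δ hδ x y x₁ x₂ hx hx₁ hx₂ hl hr
    obtain ⟨k, hk, hk'⟩ := aux_run A σ hσ x y hx
    have hside : ∀ z, (z, y) ∈ B → ((z < x ↔ z < x - σ * k) ∧ z ≠ x - σ * k) := by
      intro z hz
      have hne : ∀ i : ℕ, i ≤ k → z ≠ x - σ * i := by
        rintro i hi rfl
        exact hD _ (hk i hi) hz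
      refine ⟨?_, hne k le_rfl⟩
      by_contra hcon
      rcases hσ with rfl | rfl
      · refine hne (x - z).toNat ?_ ?_ <;> omega
      · refine hne (z - x).toNat ?_ ?_ <;> omega
    have hA := hk k le_rfl
    have hk'' : (x - σ * k - σ, y) ∉ A := by
      rwa [show x - σ * k - σ = x - σ * (k + 1) by ring]
    obtain ⟨a, ha⟩ : ∃ a, a = x - σ * k := ⟨_, rfl⟩
    rw [← ha] at hA hk'' hside
    refine ⟨a, ?_, hside⟩
    have hnP : (a - σ, y) ∉ P := by
      rw [hU]
      rintro (h | h)
      · exact hk'' h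
      · have := hcut _ hA _ h (by rcases hσ with rfl | rfl <;> simp [Adj])
        simp only at this
        omega
    by_contra hnA
    have hnP2 : (a, y + δ) ∉ P := by
      rw [hU]
      rintro (h | h)
      · exact hnA h
      · have := hcut _ hA _ h (by rcases hδ with rfl | rfl <;> simp [Adj])
        simp only at this
        omega
    have hAP : (a, y) ∈ P := (hU _).2 (Or.inl hA)
    have hnP3 : (a - σ, y + δ) ∉ P := by
      have := aux_diag_gen (↑P) hP hs σ δ a y hσ hδ (by simpa using hAP) (by simpa using hnP)
        (by simpa using hnP2)
      simpa using this
    refine hno ⟨(a, y), hA, aux_lc P σ δ a y hσ hδ hAP hnP hnP2 hnP3, (x₁, y), hx₁, (x₂, y), hx₂,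
      rfl, rfl, ?_, ?_⟩
    · exact (hside _ hx₁).1.1 hl
    · have := hside _ hx₂
      simp only
      omega
  have chain : ∀ δ : ℤ, (δ = 1 ∨ δ = -1) → ∀ M : ℤ, (∀ p ∈ A, δ * p.2 ≤ M) → ∀ n : ℕ,
      ∀ x y : ℤ, (x, y) ∈ A → M - δ * y ≤ n → ∃ s : ℤ × ℤ → Prop,
      (∀ p ∈ B, ∀ q ∈ B, Adj p q → δ * y ≤ δ * p.2 → δ * y ≤ δ * q.2 → (s p ↔ s q)) ∧
      ∀ z, (z, y) ∈ B → (s (z, y) ↔ z < x) := by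
    intro δ hδ M hM n
    induction n with
    | zero =>
      intro x y hx hn
      by_cases hbl : ∃ x₁, (x₁, y) ∈ B ∧ x₁ < x
      · by_cases hbr : ∃ x₂, (x₂, y) ∈ B ∧ x < x₂
        · obtain ⟨x₁, h1, h1'⟩ := hbl
          obtain ⟨x₂, h2, h2'⟩ := hbr
          obtain ⟨a, ha, -⟩ := step δ hδ x y x₁ x₂ hx h1 h2 h1' h2'
          have := hM _ ha
          simp only at this
          rcases hδ with rfl | rfl <;> push_cast at hn <;> omega
        · refine ⟨fun _ => True, by simp, ?_⟩
          intro z hz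
          have : z ≠ x := by rintro rfl; exact hD _ hx hz
          have : ¬ x < z := fun h => hbr ⟨z, hz, h⟩
          simp only [true_iff]; omega
      · refine ⟨fun _ => False, by simp, ?_⟩
        intro z hz
        have : ¬ z < x := fun h => hbl ⟨z, hz, h⟩
        simpa using this
    | succ n ih =>
      intro x y hx hn
      by_cases hbl : ∃ x₁, (x₁, y) ∈ B ∧ x₁ < x
      · by_cases hbr : ∃ x₂, (x₂, y) ∈ B ∧ x < x₂
        · obtain ⟨x₁, h1, h1'⟩ := hbl
          obtain ⟨x₂, h2, h2'⟩ := hbr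
          obtain ⟨a, ha, hside⟩ := step δ hδ x y x₁ x₂ hx h1 h2 h1' h2'
          obtain ⟨s, hs1, hs2⟩ := ih a (y + δ) ha
            (by rcases hδ with rfl | rfl <;> push_cast at hn <;> omega)
          refine ⟨fun p => (p.2 = y ∧ p.1 < x) ∨ (p.2 ≠ y ∧ s p), ?_, ?_⟩
          · rintro ⟨p1, p2⟩ hp ⟨q1, q2⟩ hq hadj hpy hqy
            simp only at hpy hqy ⊢
            have hcase : (q1 = p1 + 1 ∧ q2 = p2) ∨ (p1 = q1 + 1 ∧ q2 = p2) ∨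
                (q1 = p1 ∧ q2 = p2 + 1) ∨ (q1 = p1 ∧ p2 = q2 + 1) := by
              simp only [Adj] at hadj
              rcases abs_cases (p1 - q1) with ⟨e1, _⟩ | ⟨e1, _⟩ <;>
                rcases abs_cases (p2 - q2) with ⟨e2, _⟩ | ⟨e2, _⟩ <;> rw [e1, e2] at hadj <;> omega
            by_cases hp2 : p2 = y
            · by_cases hq2 : q2 = y
              · subst hp2
                subst hq2
                have : p1 ≠ x := by rintro rfl; exact hD _ hx hp
                have : q1 ≠ x := by rintro rfl; exact hD _ hx hq
                simp only [true_and, ne_eq, not_true_eq_false, false_and, or_false]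
                omega
              · have e : q2 = y + δ ∧ q1 = p1 := by
                  rcases hδ with rfl | rfl <;> omega
                obtain ⟨rfl, rfl⟩ := e
                subst hp2
                have e1 := hs2 _ hq
                have e2 := hside _ hp
                simp only [true_and, ne_eq, not_true_eq_false, false_and, or_false, hq2,
                  not_false_eq_true, false_or, e1]
                exact e2.1
            · by_cases hq2 : q2 = y
              · have e : p2 = y + δ ∧ q1 = p1 := by
                  rcases hδ with rfl | rfl <;> omega
                obtain ⟨rfl, rfl⟩ := e
                subst hq2
                have e1 := hs2 _ hp
                have e2 := hside _ hq
                simp only [true_and, ne_eq, not_true_eq_false, false_and, or_false, hp2,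
                  not_false_eq_true, false_or, e1]
                exact e2.1.symm
              · have := hs1 _ hp _ hq hadj (by rcases hδ with rfl | rfl <;> simp only <;> omega)
                  (by rcases hδ with rfl | rfl <;> simp only <;> omega)
                simp only [hp2, hq2, false_and, ne_eq, not_false_eq_true, true_and, false_or, this]
          · intro z hz
            simp
        · refine ⟨fun _ => True, by simp, ?_⟩
          intro z hz
          have : z ≠ x := by rintro rfl; exact hD _ hx hz
          have : ¬ x < z := fun h => hbr ⟨z, hz, h⟩
          simp only [true_iff]; omega
      · refine ⟨fun _ => False, by simp, ?_⟩
        intro z hz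
        have : ¬ z < x := fun h => hbl ⟨z, hz, h⟩
        simpa using this
  have full : ∀ δ : ℤ, (δ = 1 ∨ δ = -1) → ∃ s : ℤ × ℤ → Prop,
      (∀ p ∈ B, ∀ q ∈ B, Adj p q → δ * t.2 ≤ δ * p.2 → δ * t.2 ≤ δ * q.2 → (s p ↔ s q)) ∧
      ∀ z, (z, t.2) ∈ B → (s (z, t.2) ↔ z < t.1) := by
    intro δ hδ
    obtain ⟨M, hM⟩ := (A.image (fun p => δ * p.2)).bddAbove
    refine chain δ hδ M (fun p hp => hM ?_) (M - δ * t.2).toNat t.1 t.2 ht (by omega)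
    simp only [Finset.coe_image, Set.mem_image]
    exact ⟨p, by simpa using hp, rfl⟩
  obtain ⟨su, hu1, hu2⟩ := full 1 (Or.inl rfl)
  obtain ⟨sd, hd1, hd2⟩ := full (-1) (Or.inr rfl)
  obtain ⟨f, hf⟩ : ∃ f : ℤ × ℤ → Prop,
      f = fun p => (t.2 ≤ p.2 ∧ su p) ∨ (p.2 < t.2 ∧ sd p) := ⟨_, rfl⟩
  have hup : ∀ p, t.2 ≤ p.2 → (f p ↔ su p) := by
    intro p hp
    have : ¬ p.2 < t.2 := by omega
    simp [hf, hp, this]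
  have hdn : ∀ p ∈ B, p.2 ≤ t.2 → (f p ↔ sd p) := by
    rintro ⟨p1, p2⟩ hpB hp
    rcases lt_or_eq_of_le hp with h | h
    · have : ¬ t.2 ≤ p2 := by simp only at h; omega
      simp only at h
      simp [hf, h, this]
    · simp only at h
      subst h
      rw [hup (p1, t.2) le_rfl, hu2 _ hpB, hd2 _ hpB]
  have inv : ∀ q, Relation.ReflTransGen
      (fun a b => a ∈ (↑B : Set (ℤ × ℤ)) ∧ b ∈ (↑B : Set (ℤ × ℤ)) ∧ Adj a b) q₁ q →
      (f q₁ ↔ f q) := by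
    intro q hq
    induction hq with
    | refl => rfl
    | @tail p q _ hpq ih =>
      obtain ⟨hp, hq, hadj⟩ := hpq
      rw [ih]
      replace hp : p ∈ B := by simpa using hp
      replace hq : q ∈ B := by simpa using hq
      have hdist : |p.2 - q.2| ≤ 1 := by
        have := abs_nonneg (p.1 - q.1)
        simp only [Adj] at hadj
        omega
      rw [abs_le] at hdist
      by_cases h : t.2 ≤ p.2 ∧ t.2 ≤ q.2
      · rw [hup _ h.1, hup _ h.2]
        exact hu1 _ hp _ hq hadj (by omega) (by omega)
      · rw [hdn _ hp (by omega), hdn _ hq (by omega)]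
        exact hd1 _ hp _ hq hadj (by omega) (by omega)
  have hfin := inv q₂ (hB _ (by simpa using hq₁) _ (by simpa using hq₂))
  obtain ⟨a1, a2⟩ := q₁
  obtain ⟨b1, b2⟩ := q₂
  simp only at hrow₁ hrow₂ hleft hright
  subst hrow₁
  subst hrow₂
  rw [hup (a1, t.2) le_rfl, hup (b1, t.2) le_rfl, hu2 _ hq₁, hu2 _ hq₂] at hfin
  omega

/-- For a vertical straight 2-cut of a simple polyomino, if some
tile of one piece is blocked in its row by tiles of the other piece on both
sides, then some locally convex tile of that piece is so blocked. -/
theorem stmt10 (P P₁ P₂ : Finset (ℤ × ℤ)) (c : ℤ)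
    (hP : IsPolyomino P) (hs : SimplePoly P) (hcut : IsVCut P P₁ P₂ c)
    (A B : Finset (ℤ × ℤ)) (hAB : (A = P₁ ∧ B = P₂) ∨ (A = P₂ ∧ B = P₁))
    (t q₁ q₂ : ℤ × ℤ) (ht : t ∈ A) (hq₁ : q₁ ∈ B) (hq₂ : q₂ ∈ B)
    (hrow₁ : q₁.2 = t.2) (hrow₂ : q₂.2 = t.2)
    (hleft : q₁.1 < t.1) (hright : t.1 < q₂.1) :
    ∃ t' ∈ A, LocallyConvex P t' ∧ ∃ q₁' ∈ B, ∃ q₂' ∈ B,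
      q₁'.2 = t'.2 ∧ q₂'.2 = t'.2 ∧ q₁'.1 < t'.1 ∧ t'.1 < q₂'.1 := by
  obtain ⟨hU, hD, -, -, h1, h2, hc⟩ := hcut
  have hU' : ∀ p, p ∈ P ↔ p ∈ P₁ ∨ p ∈ P₂ := by
    intro p; rw [← hU, Finset.mem_union]
  have hD' : ∀ p, p ∈ P₁ → p ∈ P₂ → False := fun p a b => Finset.disjoint_left.1 hD a b
  rcases hAB with ⟨rfl, rfl⟩ | ⟨rfl, rfl⟩
  · refine aux_main P A B hP.2 hs hU' hD' h2 1 (Or.inl rfl) ?_ t q₁ q₂ ht hq₁ hq₂ hrow₁ hrow₂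
      hleft hright
    intro p hp q hq hadj
    have := hc p hp q hq hadj
    omega
  · refine aux_main P A B hP.2 hs (fun p => (hU' p).trans or_comm) (fun p a b => hD' p b a) h1
      (-1) (Or.inr rfl) ?_ t q₁ q₂ ht hq₁ hq₂ hrow₁ hrow₂ hleft hright
    intro p hp q hq hadj
    have := hc q hq p hp (by
      simp only [Adj] at hadj ⊢
      rw [abs_sub_comm q.1, abs_sub_comm q.2]; exact hadj)
    omega
end

section
/- There exists a simple polyomino P that is not orthogonally convex and that admits no valid 2-cut, i.e., for every partition of P into two nonempty subsets P₁, P₂ each inducing a connected grid graph and for every axis-parallel unit vector v ∈ {(1,0), (-1,0), (0,1), (0,-1)}, there is an integer k ≥ 1 with (P₂ + k·v) ∩ P₁ ≠ ∅. In particular, P is not 2-cuttable. -/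
/-- The 59 tiles of the polyomino, listed along the path. -/
def pathL : List (ℤ × ℤ) :=
  [(4, 6), (4, 5), (4, 4), (3, 4), (2, 4), (2, 3), (2, 2), (2, 1), (2, 0), (1, 0), (0, 0), (0,
   1), (0, 2), (0, 3), (0, 4), (0, 5), (0, 6), (0, 7), (0, 8), (0, 9), (0, 10), (1, 10), (2,
   10), (3, 10), (4, 10), (5, 10), (6, 10), (7, 10), (8, 10), (8, 9), (8, 8), (8, 7), (8, 6),
   (8, 5), (8, 4), (8, 3), (8, 2), (8, 1), (8, 0), (7, 0), (6, 0), (5, 0), (4, 0), (4, 1), (4,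
   2), (5, 2), (6, 2), (6, 3), (6, 4), (6, 5), (6, 6), (6, 7), (6, 8), (5, 8), (4, 8), (3, 8),
   (2, 8), (2, 7), (2, 6)]

/-- Complement cells in the bounding box, in breadth-first order. -/
def compL : List (ℤ × ℤ) :=
  [(3, 0), (3, 1), (3, 2), (3, 3), (4, 3), (5, 3), (5, 4), (5, 5), (5, 6), (5, 7), (4, 7), (3,
   7), (3, 6), (3, 5), (2, 5), (1, 5), (1, 6), (1, 4), (1, 7), (1, 3), (1, 8), (1, 2), (1, 9),
   (1, 1), (2, 9), (3, 9), (4, 9), (5, 9), (6, 9), (7, 9), (7, 8), (7, 7), (7, 6), (7, 5), (7,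
   4), (7, 3), (7, 2), (7, 1), (6, 1), (5, 1)]

/-- Blocking witnesses `(i, j, k)`. -/
def witL : List (ℕ × ℕ × ℤ) :=
  [(0, 50, 2), (16, 58, 2), (0, 58, 2), (0, 54, 2), (4, 58, 2), (0, 44, 4), (22, 58, 4)]

/-- The `n`-th tile of the path. -/
def tile (n : ℕ) : ℤ × ℤ := pathL.getD n (0, 0)

/-- Index of a tile. -/
def ix (a : ℤ × ℤ) : ℕ := pathL.idxOf a

lemma ix_step_aux : ∀ a ∈ pathL, ∀ b ∈ pathL,
    (a.1 - b.1).natAbs + (a.2 - b.2).natAbs = 1 → ix a = ix b + 1 ∨ ix b = ix a + 1 := by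
  decide +kernel

lemma adj_natAbs {a b : ℤ × ℤ} : Adj a b ↔ (a.1 - b.1).natAbs + (a.2 - b.2).natAbs = 1 := by
  unfold Adj
  rw [Int.abs_eq_natAbs, Int.abs_eq_natAbs]
  omega

lemma ix_step {a b : ℤ × ℤ} (ha : a ∈ pathL) (hb : b ∈ pathL) (h : Adj a b) :
    ix a = ix b + 1 ∨ ix b = ix a + 1 := ix_step_aux a ha b hb (adj_natAbs.1 h)

lemma tile_ix : ∀ a ∈ pathL, tile (ix a) = a ∧ ix a < 59 := by
  decide +kernel

lemma ix_tile : ∀ n < 59, ix (tile n) = n ∧ tile n ∈ pathL := by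
  decide +kernel

lemma tile_step : ∀ n < 58,
    ((tile n).1 - (tile (n + 1)).1).natAbs + ((tile n).2 - (tile (n + 1)).2).natAbs = 1 := by
  decide +kernel

lemma adj_symm {a b : ℤ × ℤ} (h : Adj a b) : Adj b a := by
  rw [adj_natAbs] at *
  omega

lemma reach_symm {S : Set (ℤ × ℤ)} {p q : ℤ × ℤ}
    (h : Relation.ReflTransGen (fun a b => a ∈ S ∧ b ∈ S ∧ Adj a b) p q) :
    Relation.ReflTransGen (fun a b => a ∈ S ∧ b ∈ S ∧ Adj a b) q p := by
  induction h with
  | refl => exact .refl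
  | tail _ h ih => exact .head ⟨h.2.1, h.1, adj_symm h.2.2⟩ ih

lemma conn_of_base {S : Set (ℤ × ℤ)} (o : ℤ × ℤ)
    (h : ∀ p ∈ S, Relation.ReflTransGen (fun a b => a ∈ S ∧ b ∈ S ∧ Adj a b) p o) :
    GridConnected S := fun p hp q hq => (h p hp).trans (reach_symm (h q hq))

/-- A connected subset of the path is an interval. -/
lemma interval_of_conn {S : Finset (ℤ × ℤ)} (hS : S ⊆ pathL.toFinset)
    (hc : GridConnected (S : Set (ℤ × ℤ))) {a b : ℤ × ℤ} (ha : a ∈ S) (hb : b ∈ S) {m : ℕ}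
    (h1 : ix a < m) (h2 : m < ix b) : tile m ∈ S := by
  by_contra hm
  have key : ∀ q, Relation.ReflTransGen
      (fun a b => a ∈ (S : Set (ℤ × ℤ)) ∧ b ∈ (S : Set (ℤ × ℤ)) ∧ Adj a b) a q → ix q < m := by
    intro q hq
    induction hq with
    | refl => exact h1
    | @tail x y _ h ih =>
      obtain ⟨hx, hy, hxy⟩ := h
      have hx' : x ∈ pathL := by simpa using hS hx
      have hy' : y ∈ pathL := by simpa using hS hy
      have hne : ix y ≠ m := by
        intro e
        apply hm
        rw [← e, (tile_ix y hy').1]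
        exact hy
      have := ix_step hx' hy' hxy
      omega
  have := key b (hc a ha b hb)
  omega

lemma blocked : ∀ v ∈ ([(1, 0), (-1, 0), (0, 1), (0, -1)] : List (ℤ × ℤ)), ∀ c < 59, 0 < c →
    ∃ w ∈ witL, w.1 < c ∧ c ≤ w.2.1 ∧ w.2.1 < 59 ∧ 1 ≤ w.2.2 ∧
      ((tile w.1).1 + w.2.2 * v.1, (tile w.1).2 + w.2.2 * v.2) = tile w.2.1 := by
  decide +kernel

lemma core {A B : Finset (ℤ × ℤ)} (hU : A ∪ B = pathL.toFinset) (hd : Disjoint A B)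
    (hBn : B.Nonempty) (hA : GridConnected (A : Set (ℤ × ℤ)))
    (h0 : tile 0 ∈ A) (v : ℤ × ℤ)
    (hv : v ∈ ([(1, 0), (-1, 0), (0, 1), (0, -1)] : List (ℤ × ℤ))) :
    ∃ k : ℤ, 1 ≤ k ∧ ∃ a ∈ A, (a.1 + k * v.1, a.2 + k * v.2) ∈ B := by
  classical
  have hAs : A ⊆ pathL.toFinset := hU ▸ Finset.subset_union_left
  have hBs : B ⊆ pathL.toFinset := hU ▸ Finset.subset_union_right
  have hex : ∃ c, c < 59 ∧ tile c ∈ B := by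
    obtain ⟨b, hb⟩ := hBn
    have hb' : b ∈ pathL := by simpa using hBs hb
    obtain ⟨h1, h2⟩ := tile_ix b hb'
    exact ⟨ix b, h2, by rw [h1]; exact hb⟩
  have hcover : ∀ n < 59, tile n ∈ A ∨ tile n ∈ B := by
    intro n hn
    have : tile n ∈ A ∪ B := by
      rw [hU]; simpa using (ix_tile n hn).2
    simpa using this
  have hdis : ∀ x, x ∈ A → x ∈ B → False := fun x h1 h2 => Finset.disjoint_left.1 hd h1 h2
  obtain ⟨hc, hcB⟩ := Nat.find_spec hex
  have hmin : ∀ n < Nat.find hex, ¬ (n < 59 ∧ tile n ∈ B) := fun n hn => Nat.find_min hex hn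
  generalize Nat.find hex = c at hc hcB hmin
  have hc0 : 0 < c := by
    rcases Nat.eq_zero_or_pos c with h | h
    · subst h; exact (hdis _ h0 hcB).elim
    · exact h
  obtain ⟨⟨i, j, k⟩, -, hi, hj, hj', hk, he⟩ := blocked v hv c hc hc0
  simp only at hi hj hj' hk he
  refine ⟨k, hk, tile i, ?_, ?_⟩
  · rcases hcover i (by omega) with h | h
    · exact h
    · exact (hmin i hi ⟨by omega, h⟩).elim
  · rw [he]
    rcases hcover j hj' with h | h
    · rcases Nat.eq_or_lt_of_le hj with e | e
      · rw [← e]; exact hcB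
      · refine (hdis _ (interval_of_conn hAs hA h0 h (m := c) ?_ ?_) hcB).elim
        · rw [(ix_tile 0 (by omega)).1]; exact hc0
        · rw [(ix_tile j hj').1]; exact e
    · exact h

lemma no_cut (P₁ P₂ : Finset (ℤ × ℤ)) (hU : P₁ ∪ P₂ = pathL.toFinset) (hd : Disjoint P₁ P₂)
    (h1 : P₁.Nonempty) (h2 : P₂.Nonempty) (c1 : GridConnected (P₁ : Set (ℤ × ℤ)))
    (c2 : GridConnected (P₂ : Set (ℤ × ℤ))) :
    ∀ v ∈ ({(1, 0), (-1, 0), (0, 1), (0, -1)} : Set (ℤ × ℤ)),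
      ∃ k : ℤ, 1 ≤ k ∧ ∃ p ∈ P₂, (p.1 + k * v.1, p.2 + k * v.2) ∈ P₁ := by
  intro v hv
  have h0 : tile 0 ∈ P₁ ∪ P₂ := by
    rw [hU]; simpa using (ix_tile 0 (by omega)).2
  rcases Finset.mem_union.1 h0 with h | h
  · obtain ⟨k, hk, a, ha, hb⟩ := core hU hd h2 c1 h (-v.1, -v.2) (by
      simp only [Set.mem_insert_iff, Set.mem_singleton_iff] at hv
      rcases hv with rfl | rfl | rfl | rfl <;> decide)
    refine ⟨k, hk, _, hb, ?_⟩
    have : (a.1 + k * -v.1 + k * v.1, a.2 + k * -v.2 + k * v.2) = a := by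
      ext <;> simp only <;> ring
    simp only
    rw [this]
    exact ha
  · exact core (by rw [Finset.union_comm]; exact hU) hd.symm h1 c2 h v (by simpa using hv)

lemma path_conn : GridConnected (pathL.toFinset : Set (ℤ × ℤ)) := by
  apply conn_of_base (tile 0)
  have key : ∀ n < 59, Relation.ReflTransGen (fun a b => a ∈ (pathL.toFinset : Set (ℤ × ℤ)) ∧
      b ∈ (pathL.toFinset : Set (ℤ × ℤ)) ∧ Adj a b) (tile n) (tile 0) := by
    intro n
    induction n with
    | zero => intro _; exact .refl
    | succ n ih =>
      intro hn
      refine .head ⟨?_, ?_, ?_⟩ (ih (by omega))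
      · simpa using (ix_tile (n + 1) hn).2
      · simpa using (ix_tile n (by omega)).2
      · exact adj_symm (adj_natAbs.2 (tile_step n (by omega)))
  intro p hp
  have hp' : p ∈ pathL := by simpa using hp
  obtain ⟨e, hl⟩ := tile_ix p hp'
  rw [← e]
  exact key _ hl

lemma seg_h {S : Set (ℤ × ℤ)} (y x : ℤ) (n : ℕ) (h : ∀ t, x ≤ t → t ≤ x + n → (t, y) ∈ S) :
    Relation.ReflTransGen (fun a b => a ∈ S ∧ b ∈ S ∧ Adj a b) (x, y) (x + n, y) := by
  induction n with
  | zero => simpa using Relation.ReflTransGen.refl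
  | succ n ih =>
    refine .tail (ih fun t h1 h2 => h t h1 (by push_cast; omega)) ⟨?_, ?_, ?_⟩
    · exact h _ (by omega) (by push_cast; omega)
    · exact h _ (by omega) (by omega)
    · rw [adj_natAbs]; push_cast; omega

lemma seg_v {S : Set (ℤ × ℤ)} (x y : ℤ) (n : ℕ) (h : ∀ t, y ≤ t → t ≤ y + n → (x, t) ∈ S) :
    Relation.ReflTransGen (fun a b => a ∈ S ∧ b ∈ S ∧ Adj a b) (x, y) (x, y + n) := by
  induction n with
  | zero => simpa using Relation.ReflTransGen.refl
  | succ n ih =>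
    refine .tail (ih fun t h1 h2 => h t h1 (by push_cast; omega)) ⟨?_, ?_, ?_⟩
    · exact h _ (by omega) (by push_cast; omega)
    · exact h _ (by omega) (by omega)
    · rw [adj_natAbs]; push_cast; omega

lemma seg_h' {S : Set (ℤ × ℤ)} (y x x' : ℤ)
    (h : ∀ t, min x x' ≤ t → t ≤ max x x' → (t, y) ∈ S) :
    Relation.ReflTransGen (fun a b => a ∈ S ∧ b ∈ S ∧ Adj a b) (x, y) (x', y) := by
  rcases le_total x x' with hx | hx
  · have := seg_h (S := S) y x (x' - x).toNat (fun t h1 h2 => h t (by omega) (by omega))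
    rwa [show x + ((x' - x).toNat : ℤ) = x' by omega] at this
  · have := seg_h (S := S) y x' (x - x').toNat (fun t h1 h2 => h t (by omega) (by omega))
    rw [show x' + ((x - x').toNat : ℤ) = x by omega] at this
    exact reach_symm this

lemma seg_v' {S : Set (ℤ × ℤ)} (x y y' : ℤ)
    (h : ∀ t, min y y' ≤ t → t ≤ max y y' → (x, t) ∈ S) :
    Relation.ReflTransGen (fun a b => a ∈ S ∧ b ∈ S ∧ Adj a b) (x, y) (x, y') := by
  rcases le_total y y' with hx | hx
  · have := seg_v (S := S) x y (y' - y).toNat (fun t h1 h2 => h t (by omega) (by omega))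
    rwa [show y + ((y' - y).toNat : ℤ) = y' by omega] at this
  · have := seg_v (S := S) x y' (y - y').toNat (fun t h1 h2 => h t (by omega) (by omega))
    rw [show y' + ((y - y').toNat : ℤ) = y by omega] at this
    exact reach_symm this

lemma path_box : ∀ a ∈ pathL, 0 ≤ a.1 ∧ a.1 ≤ 8 ∧ 0 ≤ a.2 ∧ a.2 ≤ 10 := by
  decide +kernel

lemma box_cover : ∀ x < 9, ∀ y < 11, (((x : ℕ) : ℤ), ((y : ℕ) : ℤ)) ∈ pathL ∨
    (((x : ℕ) : ℤ), ((y : ℕ) : ℤ)) ∈ compL := by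
  decide +kernel

lemma comp_not_path : ∀ a ∈ compL, a ∉ pathL := by
  decide +kernel

lemma comp_chain : ∀ n < compL.length, n = 0 ∨ ∃ m < n,
    ((compL.getD n (3, 0)).1 - (compL.getD m (3, 0)).1).natAbs +
      ((compL.getD n (3, 0)).2 - (compL.getD m (3, 0)).2).natAbs = 1 := by
  decide +kernel

lemma comp_getD : ∀ n < compL.length, compL.getD n (3, 0) ∈ compL := by
  decide +kernel

lemma path_simple : SimplePoly pathL.toFinset := by
  unfold SimplePoly
  apply conn_of_base (-1, -1)
  have hout : ∀ x y : ℤ, (x < 0 ∨ 8 < x ∨ y < 0 ∨ 10 < y) →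
      (x, y) ∈ ((pathL.toFinset : Set (ℤ × ℤ))ᶜ) := by
    intro x y h hm
    have := path_box (x, y) (by simpa using hm)
    simp only at this
    omega
  have hreach : ∀ x y : ℤ, (x < 0 ∨ 8 < x ∨ y < 0 ∨ 10 < y) →
      Relation.ReflTransGen (fun a b => a ∈ ((pathL.toFinset : Set (ℤ × ℤ))ᶜ) ∧
        b ∈ ((pathL.toFinset : Set (ℤ × ℤ))ᶜ) ∧ Adj a b) (x, y) (-1, -1) := by
    intro x y h
    by_cases hx : 8 < x
    · exact (seg_v' x y (-1) fun t _ _ => hout _ _ (by omega)).trans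
        (seg_h' (-1) x (-1) fun t _ _ => hout _ _ (by omega))
    · exact (seg_h' y x (-1) fun t _ _ => hout _ _ (by omega)).trans
        (seg_v' (-1) y (-1) fun t _ _ => hout _ _ (by omega))
  have hcompl : ∀ a ∈ compL, a ∈ ((pathL.toFinset : Set (ℤ × ℤ))ᶜ) := by
    intro a ha hm
    exact comp_not_path a ha (by simpa using hm)
  have hin : ∀ n < compL.length,
      Relation.ReflTransGen (fun a b => a ∈ ((pathL.toFinset : Set (ℤ × ℤ))ᶜ) ∧
        b ∈ ((pathL.toFinset : Set (ℤ × ℤ))ᶜ) ∧ Adj a b) (compL.getD n (3, 0)) (-1, -1) := by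
    intro n
    induction n using Nat.strong_induction_on with
    | _ n ih =>
      intro hn
      rcases comp_chain n hn with rfl | ⟨m, hm, hadj⟩
      · refine .head ⟨hcompl _ (comp_getD 0 hn), hout 3 (-1) (by omega), ?_⟩
          (hreach 3 (-1) (by omega))
        rw [adj_natAbs]
        decide +kernel
      · exact .head ⟨hcompl _ (comp_getD n hn), hcompl _ (comp_getD m (by omega)),
          adj_natAbs.2 hadj⟩ (ih m hm (by omega))
  rintro ⟨x, y⟩ hp
  by_cases hb : x < 0 ∨ 8 < x ∨ y < 0 ∨ 10 < y
  · exact hreach x y hb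
  · have hcov := box_cover x.toNat (by omega) y.toNat (by omega)
    have ex : ((x.toNat : ℕ) : ℤ) = x := by omega
    have ey : ((y.toNat : ℕ) : ℤ) = y := by omega
    simp only [ex, ey] at hcov
    rcases hcov with h | h
    · exact (hp (by simpa using h)).elim
    · obtain ⟨n, hn, e⟩ := List.getElem_of_mem h
      have := hin n hn
      rwa [List.getD_eq_getElem _ _ hn, e] at this

lemma path_not_convex : ¬ OrthoConvex (pathL.toFinset : Set (ℤ × ℤ)) := by
  rintro ⟨-, h⟩
  have h2 : ((2, 0) : ℤ × ℤ) ∈ pathL := by decide +kernel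
  have h4 : ((4, 0) : ℤ × ℤ) ∈ pathL := by decide +kernel
  have h3 : ((3, 0) : ℤ × ℤ) ∉ pathL := by decide +kernel
  have := h 0 2 4 3 (by simpa using h2) (by simpa using h4) (by omega) (by omega)
  exact h3 (by simpa using this)

/-- There exists a simple polyomino that is not orthogonally
convex and admits no valid 2-cut; in particular it is not 2-cuttable. -/
theorem stmt13 :
    ∃ P : Finset (ℤ × ℤ), IsPolyomino P ∧ SimplePoly P ∧ ¬ OrthoConvex ↑P ∧
      (∀ P₁ P₂ : Finset (ℤ × ℤ), P₁ ∪ P₂ = P → Disjoint P₁ P₂ →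
        P₁.Nonempty → P₂.Nonempty → GridConnected ↑P₁ → GridConnected ↑P₂ →
        ∀ v ∈ ({(1, 0), (-1, 0), (0, 1), (0, -1)} : Set (ℤ × ℤ)),
          ∃ k : ℤ, 1 ≤ k ∧ ∃ p ∈ P₂, (p.1 + k * v.1, p.2 + k * v.2) ∈ P₁) ∧
      ¬ TwoCuttable P := by
  refine ⟨pathL.toFinset, ⟨⟨tile 0, by simpa using (ix_tile 0 (by omega)).2⟩, path_conn⟩,
    path_simple, path_not_convex, no_cut, ?_⟩
  intro h
  generalize hP : pathL.toFinset = P at h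
  cases h with
  | convex _ _ hc => exact path_not_convex (hP ▸ hc)
  | cut _ P₁ P₂ hcut _ _ =>
    obtain ⟨hU, hd, h1, h2, c1, c2, v, hv, hk⟩ := hcut
    obtain ⟨k, hk1, p, hp, hm⟩ := no_cut P₁ P₂ (hU.trans hP.symm) hd h1 h2 c1 c2 v hv
    exact hk k hk1 p hp hm
end
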